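/- arXiv:0904.3269 — 4 statements merged into one kernel-verified Lean document; each statement's English description precedes it below -/
import Mathlib

section
/- For every n ≥ 1, the operator identity ∂∘D + D∘∂ = id holds on ℤΣ_n, where ∂ : ℤΣ_n → ℤΣ_{n−1} and D : ℤΣ_{n−1} → ℤΣ_n, D : ℤΣ_n → ℤΣ_{n+1} are as defined; thus D is a contracting homotopy for the chain complex (ℤΣ_*, ∂). -/
open Equiv

/-- The `j`-th face of a permutation of `Fin (n+1)`: delete the entry `σ j` from the
one-line notation and decrease by one every remaining entry exceeding `σ j`. -/
def permFace {n : ℕ} (σ : Equiv.Perm (Fin (n + 1))) (j : Fin (n + 1)) :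
    Equiv.Perm (Fin n) :=
  (finSuccAboveEquiv j).trans
    ((σ.subtypeEquiv (fun a => (σ.injective.ne_iff (x := a) (y := j)).symm)).trans
      (finSuccAboveEquiv (σ j)).symm)

/-- The hat `σ̂ ∈ Σ_{n+1}` of `σ ∈ Σ_n`: `σ̂ 0 = 0` and `σ̂ (j+1) = σ j + 1`. -/
def permHat {n : ℕ} (σ : Equiv.Perm (Fin n)) : Equiv.Perm (Fin (n + 1)) :=
  (finSuccEquiv n).symm.permCongr σ.optionCongr

/-- The alternating-sum boundary map `∂ : ℤΣ_{n+1} → ℤΣ_n`. -/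
def permBdry (n : ℕ) :
    FreeAbelianGroup (Equiv.Perm (Fin (n + 1))) →+ FreeAbelianGroup (Equiv.Perm (Fin n)) :=
  FreeAbelianGroup.lift fun σ =>
    ∑ j : Fin (n + 1), (-1 : ℤ) ^ (j : ℕ) • FreeAbelianGroup.of (permFace σ j)

/-- The linear extension `D : ℤΣ_n → ℤΣ_{n+1}` of the hat operation. -/
def permHatMap (n : ℕ) :
    FreeAbelianGroup (Equiv.Perm (Fin n)) →+ FreeAbelianGroup (Equiv.Perm (Fin (n + 1))) :=
  FreeAbelianGroup.lift fun σ => FreeAbelianGroup.of (permHat σ)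

/-- The number of orbits (cycles, counting fixed points) of a permutation of `Fin m`. -/
def permCyc {m : ℕ} (π : Equiv.Perm (Fin m)) : ℕ :=
  π.cycleType.card + (Finset.univ.filter fun x => π x = x).card

/-- The genus `S_2(σ) = (m − Cyc(c_m σ⁻¹ c_m⁻¹ σ))/2` of `σ ∈ Σ_m`. -/
def permS2 {m : ℕ} (σ : Equiv.Perm (Fin m)) : ℕ :=
  (m - permCyc (finRotate m * σ⁻¹ * (finRotate m)⁻¹ * σ)) / 2

/-- The genus `S_1(σ) = ((m+1) − Cyc(c_{m+1} σ̂⁻¹ c_{m+1}⁻¹ σ̂))/2` of `σ ∈ Σ_m`. -/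
def permS1 {m : ℕ} (σ : Equiv.Perm (Fin m)) : ℕ :=
  ((m + 1) -
    permCyc (finRotate (m + 1) * (permHat σ)⁻¹ * (finRotate (m + 1))⁻¹ * permHat σ)) / 2

theorem succAbove_permFace {n : ℕ} (σ : Equiv.Perm (Fin (n + 1))) (j : Fin (n + 1)) (i : Fin n) :
    (σ j).succAbove (permFace σ j i) = σ (j.succAbove i) := by
  have h := congrArg Subtype.val ((finSuccAboveEquiv (σ j)).apply_symm_apply
    ((σ.subtypeEquiv (fun a => (σ.injective.ne_iff (x := a) (y := j)).symm))
      (finSuccAboveEquiv j i)))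
  rwa [finSuccAboveEquiv_apply] at h

@[simp]
theorem permHat_zero {n : ℕ} (σ : Equiv.Perm (Fin n)) : permHat σ 0 = 0 := by
  simp [permHat, Equiv.permCongr_apply]

@[simp]
theorem permHat_succ {n : ℕ} (σ : Equiv.Perm (Fin n)) (j : Fin n) :
    permHat σ j.succ = (σ j).succ := by
  simp [permHat, Equiv.permCongr_apply]

theorem permFace_permHat_zero {n : ℕ} (σ : Equiv.Perm (Fin n)) :
    permFace (permHat σ) 0 = σ := by
  ext1 i
  apply Fin.succAbove_right_injective (p := permHat σ 0)
  rw [succAbove_permFace]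
  simp

theorem permFace_permHat_succ {n : ℕ} (σ : Equiv.Perm (Fin (n + 1))) (j : Fin (n + 1)) :
    permFace (permHat σ) j.succ = permHat (permFace σ j) := by
  ext1 i
  apply Fin.succAbove_right_injective (p := permHat σ j.succ)
  rw [succAbove_permFace]
  cases i using Fin.cases with
  | zero => simp
  | succ i => simp [succAbove_permFace]

/-- For every `n ≥ 1` (here `n = m + 1`), the identity `∂ ∘ D + D ∘ ∂ = id`
holds on `ℤΣ_n`; that is, `D` is a contracting homotopy for the chain complex `(ℤΣ_*, ∂)`. -/
theorem contracting_homotopy (m : ℕ) :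
    (permBdry (m + 1)).comp (permHatMap (m + 1)) + (permHatMap m).comp (permBdry m) =
      AddMonoidHom.id (FreeAbelianGroup (Equiv.Perm (Fin (m + 1)))) := by
  ext σ
  simp only [permBdry, permHatMap, AddMonoidHom.add_apply, AddMonoidHom.comp_apply,
    AddMonoidHom.id_apply, FreeAbelianGroup.lift_apply_of, map_sum, map_zsmul,
    Fin.sum_univ_succ (n := m + 1), permFace_permHat_zero, permFace_permHat_succ,
    Fin.val_zero, Fin.val_succ, pow_zero, one_smul, pow_succ, mul_neg_one, neg_smul,
    Finset.sum_neg_distrib, neg_add_cancel_right]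
end

section
/- Let g ≥ 2 be an even integer and let τ ∈ Σ_{g+1} be the permutation with one-line notation [2 0 1 3 4 ⋯ g], i.e. τ(0)=2, τ(1)=0, τ(2)=1 and τ(j)=j for 3 ≤ j ≤ g. Then ∂(τ) = e_g, the identity permutation of Σ_g, regarded as a generator of ℤΣ_g; in particular ∂(τ) = ∂(e_{g+1}), where e_{g+1} is the identity of Σ_{g+1}. -/
open Equiv

theorem Fin.val_succAbove_eq_ite {n : ℕ} (p : Fin (n + 1)) (i : Fin n) :
    (p.succAbove i : ℕ) = if (i : ℕ) < p then (i : ℕ) else i + 1 := by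
  simp only [Fin.succAbove, Fin.lt_def, Fin.val_castSucc]
  split_ifs <;> simp

/-- Two consecutive entries of the form `v, v + 1` give equal faces. -/
theorem permFace_castSucc_eq_permFace_succ {n : ℕ} (σ : Equiv.Perm (Fin (n + 1))) (i : Fin n)
    (h : (σ i.succ : ℕ) = σ i.castSucc + 1) :
    permFace σ i.castSucc = permFace σ i.succ := by
  ext x
  have h₁ := congrArg Fin.val (succAbove_permFace σ i.castSucc x)
  have h₂ := congrArg Fin.val (succAbove_permFace σ i.succ x)
  rw [Fin.val_succAbove_eq_ite] at h₁ h₂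
  rcases eq_or_ne x i with rfl | hx
  · rw [Fin.succAbove_castSucc_self] at h₁
    rw [Fin.succAbove_succ_self] at h₂
    split_ifs at h₁ h₂ <;> omega
  · have hs : i.castSucc.succAbove x = i.succ.succAbove x := by
      ext
      have := Fin.val_ne_of_ne hx
      rw [Fin.val_succAbove_eq_ite, Fin.val_succAbove_eq_ite, Fin.val_castSucc, Fin.val_succ]
      split_ifs <;> omega
    have hne₁ : (σ (i.castSucc.succAbove x) : ℕ) ≠ σ i.castSucc :=
      Fin.val_ne_of_ne (σ.injective.ne (Fin.succAbove_ne _ _))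
    have hne₂ : (σ (i.succ.succAbove x) : ℕ) ≠ σ i.succ :=
      Fin.val_ne_of_ne (σ.injective.ne (Fin.succAbove_ne _ _))
    rw [hs] at h₁ hne₁
    split_ifs at h₁ h₂ <;> omega

theorem alternating_sum_eq_zero_term {A : Type*} [AddCommGroup A] (m : ℕ)
    (f : Fin (2 * m + 1) → A)
    (hf : ∀ i : Fin (2 * m), Even (i : ℕ) ∨ f i.castSucc = f i.succ) :
    ∑ j : Fin (2 * m + 1), (-1 : ℤ) ^ (j : ℕ) • f j = f 0 := by
  induction m with
  | zero => simp
  | succ m ih =>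
    have h := (hf (Fin.last (2 * m + 1))).resolve_left (by simp)
    have ih' := ih (fun j => f j.castSucc.castSucc) fun i => hf i.castSucc.castSucc
    change ∑ j : Fin (2 * m + 1 + 1 + 1), (-1 : ℤ) ^ (j : ℕ) • f j = f 0
    rw [Fin.sum_univ_castSucc, Fin.sum_univ_castSucc]
    simp only [Fin.val_castSucc, Fin.val_last]
    refine (congrArg₂ _ (congrArg₂ _ ih' rfl) rfl).trans ?_
    rw [h, Fin.succ_last, pow_succ (-1 : ℤ) (2 * m + 1)]
    simp

/-- The boundary is the zeroth face if every entry at an odd position is followed by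
its successor. -/
theorem permBdry_of_eq_of_permFace_zero {n : ℕ} (hn : Even n) (σ : Equiv.Perm (Fin (n + 1)))
    (hσ : ∀ i : Fin n, Odd (i : ℕ) → (σ i.succ : ℕ) = σ i.castSucc + 1) :
    permBdry n (FreeAbelianGroup.of σ) = FreeAbelianGroup.of (permFace σ 0) := by
  obtain ⟨m, rfl⟩ := even_iff_two_dvd.mp hn
  rw [permBdry, FreeAbelianGroup.lift_apply_of]
  refine alternating_sum_eq_zero_term m (fun j => FreeAbelianGroup.of (permFace σ j)) fun i => ?_
  rcases Nat.even_or_odd (i : ℕ) with hi | hi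
  · exact Or.inl hi
  · exact Or.inr (congrArg _ (permFace_castSucc_eq_permFace_succ σ i (hσ i hi)))

theorem permFace_one {n : ℕ} (j : Fin (n + 1)) :
    permFace (1 : Equiv.Perm (Fin (n + 1))) j = 1 := by
  ext1 x
  exact Fin.succAbove_right_injective (succAbove_permFace 1 j x)

/-- Let `g ≥ 2` be even and let `τ ∈ Σ_{g+1}` be the permutation
`[2 0 1 3 4 ⋯ g]`, i.e. `τ 0 = 2`, `τ 1 = 0`, `τ 2 = 1` and `τ j = j` for `3 ≤ j ≤ g`.
Then `∂ τ = e_g` in `ℤΣ_g`; in particular `∂ τ = ∂ e_{g+1}`. -/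
theorem bdry_of_tau (g : ℕ) (hg : 2 ≤ g) (hge : Even g) (τ : Equiv.Perm (Fin (g + 1)))
    (hτ0 : τ ⟨0, by omega⟩ = ⟨2, by omega⟩)
    (hτ1 : τ ⟨1, by omega⟩ = ⟨0, by omega⟩)
    (hτ2 : τ ⟨2, by omega⟩ = ⟨1, by omega⟩)
    (hτ : ∀ j : Fin (g + 1), 3 ≤ (j : ℕ) → τ j = j) :
    permBdry g (FreeAbelianGroup.of τ) = FreeAbelianGroup.of (1 : Equiv.Perm (Fin g)) ∧
    permBdry g (FreeAbelianGroup.of τ) =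
      permBdry g (FreeAbelianGroup.of (1 : Equiv.Perm (Fin (g + 1)))) := by
  have hτ' : ∀ j : Fin (g + 1), (τ j : ℕ) =
      if (j : ℕ) = 0 then 2 else if (j : ℕ) < 3 then (j : ℕ) - 1 else j := by
    rintro ⟨j, hj⟩
    match j, hj with
    | 0, _ => rw [hτ0]; rfl
    | 1, _ => simp [hτ1]
    | 2, _ => simp [hτ2]
    | k + 3, _ => simp [hτ]
  have hface : permFace τ 0 = 1 := by
    ext x
    have h := congrArg Fin.val (succAbove_permFace τ 0 x)
    rw [Fin.val_succAbove_eq_ite, hτ', hτ', Fin.succAbove_zero] at h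
    simp only [Fin.val_zero, Fin.val_succ, if_true] at h
    rw [Equiv.Perm.one_apply]
    split_ifs at h <;> omega
  have h₁ : permBdry g (FreeAbelianGroup.of τ) = FreeAbelianGroup.of 1 := by
    rw [permBdry_of_eq_of_permFace_zero hge, hface]
    intro i hi
    obtain ⟨k, hk⟩ := hi
    rw [hτ', hτ', Fin.val_succ, Fin.val_castSucc]
    split_ifs <;> first | contradiction | omega
  refine ⟨h₁, h₁.trans ?_⟩
  rw [permBdry_of_eq_of_permFace_zero hge 1 (by simp), permFace_one]
end

section
/- For every m ≥ 1 and every σ ∈ Σ_m, the number m − Cyc(c_m σ⁻¹ c_m⁻¹ σ) is a nonnegative even integer. (Consequently the genus S_2(σ) = (m − Cyc(c_m σ⁻¹ c_m⁻¹ σ))/2 of a permutation is a well-defined natural number.) -/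
open Equiv

theorem sum_cycleType_add_card_fixed {m : ℕ} (π : Equiv.Perm (Fin m)) :
    π.cycleType.sum + (Finset.univ.filter fun x => π x = x).card = m := by
  have h := Finset.card_filter_add_card_filter_not
    (s := (Finset.univ : Finset (Fin m))) (fun x => π x = x)
  rw [Finset.card_univ, Fintype.card_fin] at h
  rw [Equiv.Perm.sum_cycleType, add_comm]
  exact h

theorem permCyc_le {m : ℕ} (π : Equiv.Perm (Fin m)) : permCyc π ≤ m := by
  have hcard : π.cycleType.card ≤ π.cycleType.sum := by
    have h := Multiset.card_nsmul_le_sum (s := π.cycleType) (a := 1)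
      fun _ hx => (Equiv.Perm.one_lt_of_mem_cycleType hx).le
    simpa using h
  have h := sum_cycleType_add_card_fixed π
  unfold permCyc
  omega

theorem even_sub_permCyc_of_sign_eq_one {m : ℕ} {π : Equiv.Perm (Fin m)}
    (hπ : Equiv.Perm.sign π = 1) : Even ((m : ℤ) - permCyc π) := by
  have heven : Even (π.cycleType.sum + π.cycleType.card) := by
    rw [Equiv.Perm.sign_of_cycleType] at hπ
    exact (neg_one_pow_eq_one_iff_even (by decide)).mp hπ
  have h := sum_cycleType_add_card_fixed π
  unfold permCyc
  rw [Nat.even_iff] at heven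
  rw [Int.even_iff]
  omega

/-- For every `m ≥ 1` and every `σ ∈ Σ_m`, the integer
`m − Cyc(c_m σ⁻¹ c_m⁻¹ σ)` is nonnegative and even (so the genus `S_2 σ` is a
well-defined natural number). -/
theorem genus_welldefined (m : ℕ) (hm : 1 ≤ m) (σ : Equiv.Perm (Fin m)) :
    0 ≤ (m : ℤ) - permCyc (finRotate m * σ⁻¹ * (finRotate m)⁻¹ * σ) ∧
    Even ((m : ℤ) - permCyc (finRotate m * σ⁻¹ * (finRotate m)⁻¹ * σ)) := by
  refine ⟨sub_nonneg.mpr (by exact_mod_cast permCyc_le _),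
    even_sub_permCyc_of_sign_eq_one ?_⟩
  simp only [Equiv.Perm.sign_mul, Equiv.Perm.sign_inv]
  rw [mul_right_comm (Equiv.Perm.sign (finRotate m)), Int.units_mul_self, one_mul,
    Int.units_mul_self]
end

section
/- For every m ≥ 1, every σ ∈ Σ_{m+1}, and every 0 ≤ j ≤ m, the genus of a face satisfies S_2(σ) − 1 ≤ S_2(∂_j(σ)) ≤ S_2(σ). -/
open Equiv

/-- The functions invariant under a permutation, as a subspace of the rational functions. -/
def invariantFunctions {α : Type*} (π : Equiv.Perm α) : Submodule ℚ (α → ℚ) where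
  carrier := {f | ∀ x, f (π x) = f x}
  add_mem' hf hg x := by simp [hf x, hg x]
  zero_mem' _ := rfl
  smul_mem' c f hf x := by simp [hf x]

theorem apply_eq_of_sameCycle {α : Type*} {π : Equiv.Perm α} {f : α → ℚ}
    (hf : f ∈ invariantFunctions π) {x y : α} (h : π.SameCycle x y) : f x = f y := by
  obtain ⟨k, rfl⟩ := h
  induction k using Int.induction_on with
  | zero => simp
  | succ k ih => rw [add_comm, zpow_add, zpow_one, Perm.mul_apply, hf, ih]
  | pred k ih =>
    rw [ih, ← hf ((π ^ (-(k : ℤ) - 1)) x), ← Perm.mul_apply, ← zpow_one_add]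
    congr 3
    ring

/-- Invariant functions are the functions on the set of orbits. -/
def invariantFunctionsEquiv {α : Type*} (π : Equiv.Perm α) :
    invariantFunctions π ≃ₗ[ℚ] (Quotient (Perm.SameCycle.setoid π) → ℚ) where
  toFun f := Quotient.lift f.1 fun _ _ h => apply_eq_of_sameCycle f.2 h
  invFun g := ⟨fun x => g (Quotient.mk _ x), fun x =>
    congrArg g (Quotient.sound (Perm.sameCycle_apply_left.2 (Perm.SameCycle.refl π x)))⟩
  left_inv _ := rfl
  right_inv g := by
    ext q
    induction q using Quotient.inductionOn
    rfl
  map_add' f g := by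
    ext q
    induction q using Quotient.inductionOn
    rfl
  map_smul' c f := by
    ext q
    induction q using Quotient.inductionOn
    rfl

theorem card_orbits_eq_permCyc {m : ℕ} (π : Equiv.Perm (Fin m)) :
    Nat.card (Quotient (Perm.SameCycle.setoid π)) = permCyc π := by
  classical
  let g : Fin m → π.cycleFactorsFinset ⊕ {x // x ∈ Finset.univ.filter fun x => π x = x} := fun x =>
    if h : π x = x then Sum.inr ⟨x, by simpa using h⟩
    else Sum.inl ⟨π.cycleOf x,
      Perm.cycleOf_mem_cycleFactorsFinset_iff.2 (Perm.mem_support.2 h)⟩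
  have hg : ∀ x y, π.SameCycle x y ↔ g x = g y := by
    intro x y
    by_cases hx : π x = x <;> by_cases hy : π y = y
    · simp only [g, hx, hy, dite_true, Sum.inr.injEq, Subtype.mk.injEq]
      exact ⟨fun h => h.eq_of_left hx, fun h => h ▸ Perm.SameCycle.refl _ _⟩
    · simp only [g, hx, hy, dite_true, dite_false, reduceCtorEq, iff_false]
      exact fun h => hy (h.apply_eq_self_iff.1 hx)
    · simp only [g, hx, hy, dite_true, dite_false, reduceCtorEq, iff_false]
      exact fun h => hx (h.apply_eq_self_iff.2 hy)
    · simp only [g, hx, hy, dite_false, Sum.inl.injEq, Subtype.mk.injEq]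
      exact Perm.sameCycle_iff_cycleOf_eq_of_mem_support (Perm.mem_support.2 hx)
        (Perm.mem_support.2 hy)
  have hsurj : Function.Surjective g := by
    rintro (⟨c, hc⟩ | ⟨x, hx⟩)
    · obtain ⟨x, hx⟩ := (Perm.mem_cycleFactorsFinset_iff.1 hc).1.nonempty_support
      have hcx := Perm.cycle_is_cycleOf hx hc
      have hpx : π x ≠ x := Perm.mem_support.1 (Perm.mem_cycleFactorsFinset_support_le hc hx)
      exact ⟨x, by simp [g, hpx, hcx]⟩
    · have hx' : π x = x := by simpa using hx
      exact ⟨x, by simp [g, hx']⟩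
  have hbij : Function.Bijective (Quotient.lift (s := Perm.SameCycle.setoid π) g
      fun x y h => (hg x y).1 h) := by
    constructor
    · intro p q
      induction p, q using Quotient.inductionOn₂ with
      | h x y => exact fun h => Quotient.sound ((hg x y).2 h)
    · intro y
      obtain ⟨x, rfl⟩ := hsurj y
      exact ⟨Quotient.mk _ x, rfl⟩
  rw [Nat.card_congr (Equiv.ofBijective _ hbij), Nat.card_sum, permCyc, Perm.cycleType_def,
    Multiset.card_map, Nat.card_eq_fintype_card, Nat.card_eq_fintype_card, Fintype.card_coe,
    Fintype.card_coe]
  rfl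

theorem finrank_invariantFunctions {m : ℕ} (π : Equiv.Perm (Fin m)) :
    Module.finrank ℚ (invariantFunctions π) = permCyc π := by
  classical
  rw [(invariantFunctionsEquiv π).finrank_eq, Module.finrank_fintype_fun_eq_card,
    ← card_orbits_eq_permCyc, Nat.card_eq_fintype_card]

/-- The functions taking the same value at two points. -/
def agreeAt {α : Type*} (a b : α) : Submodule ℚ (α → ℚ) :=
  LinearMap.ker (LinearMap.proj (R := ℚ) (φ := fun _ : α => ℚ) a - LinearMap.proj b)

theorem mem_agreeAt {α : Type*} {a b : α} {f : α → ℚ} : f ∈ agreeAt a b ↔ f a = f b := by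
  simp [agreeAt, sub_eq_zero]

theorem apply_swap_of_mem_agreeAt {α : Type*} [DecidableEq α] {a b : α} {f : α → ℚ}
    (hf : f ∈ agreeAt a b) (x : α) : f (swap a b x) = f x := by
  rw [mem_agreeAt] at hf
  rw [swap_apply_def]
  split_ifs with h₁ h₂ <;> simp_all

theorem invariantFunctions_inf_agreeAt_le {α : Type*} [DecidableEq α] (π : Equiv.Perm α)
    (a b : α) : invariantFunctions π ⊓ agreeAt a b ≤ invariantFunctions (swap a b * π) := by
  rintro f ⟨hf, hab⟩ x
  rw [Perm.mul_apply, apply_swap_of_mem_agreeAt hab, hf]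

theorem finrank_le_finrank_inf_agreeAt_add_one {m : ℕ} (W : Submodule ℚ (Fin m → ℚ))
    (a b : Fin m) :
    Module.finrank ℚ W ≤ Module.finrank ℚ (W ⊓ agreeAt a b : Submodule ℚ (Fin m → ℚ)) + 1 := by
  let φ : (Fin m → ℚ) →ₗ[ℚ] ℚ :=
    LinearMap.proj (R := ℚ) (φ := fun _ : Fin m => ℚ) a - LinearMap.proj b
  have h₁ := LinearMap.finrank_range_add_finrank_ker φ
  have h₂ := Submodule.finrank_sup_add_finrank_inf_eq W (agreeAt a b)
  have h₃ : Module.finrank ℚ (LinearMap.range φ) ≤ 1 := by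
    simpa using Submodule.finrank_le (LinearMap.range φ)
  have h₄ := Submodule.finrank_le (W ⊔ agreeAt a b)
  change _ + Module.finrank ℚ (agreeAt a b) = _ at h₁
  omega

theorem permCyc_le_permCyc_swap_mul_add_one {m : ℕ} (π : Equiv.Perm (Fin m)) (a b : Fin m) :
    permCyc π ≤ permCyc (swap a b * π) + 1 := by
  rw [← finrank_invariantFunctions, ← finrank_invariantFunctions]
  exact (finrank_le_finrank_inf_agreeAt_add_one _ a b).trans
    (Nat.add_le_add_right (Submodule.finrank_mono (invariantFunctions_inf_agreeAt_le π a b)) 1)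

theorem permCyc_swap_mul_le_permCyc_add_one {m : ℕ} (π : Equiv.Perm (Fin m)) (a b : Fin m) :
    permCyc (swap a b * π) ≤ permCyc π + 1 := by
  simpa using permCyc_le_permCyc_swap_mul_add_one (swap a b * π) a b

theorem permCyc_swap_mul_lt_of_apply_eq_self {m : ℕ} {π : Equiv.Perm (Fin m)} {a b : Fin m}
    (ha : π a = a) (hab : a ≠ b) : permCyc (swap a b * π) < permCyc π := by
  rw [← finrank_invariantFunctions, ← finrank_invariantFunctions]
  have hagree : ∀ f ∈ invariantFunctions (swap a b * π), f ∈ agreeAt a b := fun f hf => by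
    have := hf a
    rw [Perm.mul_apply, ha, swap_apply_left] at this
    exact mem_agreeAt.2 this.symm
  refine Submodule.finrank_lt_finrank_of_lt (lt_of_le_of_ne (fun f hf => ?_) fun h => ?_)
  · simpa using invariantFunctions_inf_agreeAt_le (swap a b * π) a b ⟨hf, hagree f hf⟩
  · have hmem : Pi.single a 1 ∈ invariantFunctions π := fun x => by
      by_cases hx : x = a
      · rw [hx, ha]
      · have : π x ≠ a := fun h' => hx (π.injective (h'.trans ha.symm))
        simp [hx, this]
    have := mem_agreeAt.1 (hagree _ (h ▸ hmem))
    simp [hab.symm] at this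

theorem permCyc_add_sum_cycleType {m : ℕ} (π : Equiv.Perm (Fin m)) :
    permCyc π + π.cycleType.sum = π.cycleType.card + m := by
  have h := Finset.card_filter_add_card_filter_not (s := Finset.univ) (fun x : Fin m => π x = x)
  rw [Finset.card_univ, Fintype.card_fin] at h
  rw [permCyc, Perm.sum_cycleType, Perm.support, add_assoc, h]

theorem permCyc_conj {m : ℕ} (π τ : Equiv.Perm (Fin m)) :
    permCyc (τ * π * τ⁻¹) = permCyc π := by
  have h₁ := permCyc_add_sum_cycleType (τ * π * τ⁻¹)
  have h₂ := permCyc_add_sum_cycleType π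
  rw [Perm.cycleType_conj] at h₁
  omega

theorem permCyc_mul_swap {m : ℕ} (π : Equiv.Perm (Fin m)) (a b : Fin m) :
    permCyc (π * swap a b) = permCyc (swap a b * π) := by
  rw [← permCyc_conj (π * swap a b) (swap a b)]
  simp [mul_assoc]

theorem permCyc_extendDomain {m n : ℕ} {p : Fin n → Prop} [DecidablePred p]
    (π : Equiv.Perm (Fin m)) (e : Fin m ≃ Subtype p) :
    permCyc (π.extendDomain e) + m = permCyc π + n := by
  have h₁ := permCyc_add_sum_cycleType (π.extendDomain e)
  have h₂ := permCyc_add_sum_cycleType π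
  rw [Perm.cycleType_extendDomain] at h₁
  omega

theorem succAbove_permFace_inv {n : ℕ} (σ : Equiv.Perm (Fin (n + 1))) (j : Fin (n + 1))
    (i : Fin n) : j.succAbove ((permFace σ j)⁻¹ i) = σ⁻¹ ((σ j).succAbove i) := by
  rw [Perm.eq_inv_iff_eq, ← succAbove_permFace, Perm.inv_def, apply_symm_apply]

theorem val_finRotate {n : ℕ} (i : Fin n) :
    (finRotate n i : ℕ) = if (i : ℕ) + 1 = n then 0 else (i : ℕ) + 1 := by
  obtain _ | n := n
  · exact i.elim0
  rw [finRotate_apply, Fin.val_add_one]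
  simp [Fin.ext_iff]

theorem succAbove_finRotate {n : ℕ} (j : Fin (n + 1)) (i : Fin n) :
    j.succAbove (finRotate n i) =
      swap j (finRotate (n + 1) j) (finRotate (n + 1) (j.succAbove i)) := by
  have hj := j.2
  have hi := i.2
  simp only [swap_apply_def, Fin.succAbove, Fin.ext_iff, Fin.lt_def, apply_ite Fin.val,
    val_finRotate, Fin.val_castSucc, Fin.val_succ]
  grind

theorem succAbove_finRotate_inv {n : ℕ} (j : Fin (n + 1)) (i : Fin n) :
    j.succAbove ((finRotate n)⁻¹ i) =
      (finRotate (n + 1))⁻¹ (swap j (finRotate (n + 1) j) (j.succAbove i)) := by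
  rw [Perm.eq_inv_iff_eq, ← swap_apply_eq_iff, ← succAbove_finRotate, Perm.inv_def, apply_symm_apply]

/-- The permutation whose cycles are counted by the genus of a face, extended by a fixed point,
differs from that of the original permutation by a transposition on either side. -/
theorem extendDomain_permFace_commutator {n : ℕ} (σ : Equiv.Perm (Fin (n + 1)))
    (j : Fin (n + 1)) :
    (finRotate n * (permFace σ j)⁻¹ * (finRotate n)⁻¹ * permFace σ j).extendDomain
        (finSuccAboveEquiv j) =
      swap j (finRotate (n + 1) j) *
        ((finRotate (n + 1) * σ⁻¹ * (finRotate (n + 1))⁻¹ * σ) *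
          swap j (σ⁻¹ (finRotate (n + 1) (σ j)))) := by
  ext1 x
  have hs : ∀ y, σ (swap j (σ⁻¹ (finRotate (n + 1) (σ j))) y) =
      swap (σ j) (finRotate (n + 1) (σ j)) (σ y) := fun y => by
    rw [← Perm.mul_apply, mul_swap_eq_swap_mul, Perm.inv_def, apply_symm_apply, Perm.mul_apply]
  simp only [Perm.mul_apply, hs]
  obtain rfl | ⟨i, rfl⟩ := j.eq_self_or_eq_succAbove x
  · rw [Perm.extendDomain_apply_not_subtype _ _ (by simp)]
    simp
  · have h := Perm.extendDomain_apply_image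
      (finRotate n * (permFace σ j)⁻¹ * (finRotate n)⁻¹ * permFace σ j) (finSuccAboveEquiv j) i
    simp only [finSuccAboveEquiv_apply, Perm.mul_apply] at h
    rw [h, succAbove_finRotate, succAbove_permFace_inv, succAbove_finRotate_inv,
      succAbove_permFace]

/-- For every `m ≥ 1`, every `σ ∈ Σ_{m+1}` and every `0 ≤ j ≤ m`, the
genus of a face satisfies `S_2 σ − 1 ≤ S_2 (∂_j σ) ≤ S_2 σ`. -/
theorem genus2_face (m : ℕ) (hm : 1 ≤ m) (σ : Equiv.Perm (Fin (m + 1))) (j : Fin (m + 1)) :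
    (permS2 σ : ℤ) - 1 ≤ (permS2 (permFace σ j) : ℤ) ∧
    (permS2 (permFace σ j) : ℤ) ≤ (permS2 σ : ℤ) := by
  have hne : ∀ x : Fin (m + 1), finRotate (m + 1) x ≠ x := fun x => by
    obtain ⟨m, rfl⟩ := Nat.exists_eq_add_of_le' hm
    simp
  set P := finRotate (m + 1) * σ⁻¹ * (finRotate (m + 1))⁻¹ * σ with hP
  set Q := finRotate m * (permFace σ j)⁻¹ * (finRotate m)⁻¹ * permFace σ j with hQ
  set R := Q.extendDomain (finSuccAboveEquiv j) with hR
  set a := finRotate (m + 1) j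
  set b := σ⁻¹ (finRotate (m + 1) (σ j)) with hb
  have hRP : R = swap j a * (P * swap j b) := extendDomain_permFace_commutator σ j
  have hPR : P = swap j a * (R * swap j b) := by simp [hRP, mul_assoc]
  have hcard : permCyc R + m = permCyc Q + (m + 1) := permCyc_extendDomain Q _
  have hjb : j ≠ b := fun h => hne (σ j) (by rw [← Perm.eq_inv_iff_eq.1 (h.trans hb)])
  have hRj : R j = j := Perm.extendDomain_apply_not_subtype _ _ (by simp)
  have h₁ := permCyc_swap_mul_lt_of_apply_eq_self hRj hjb
  have h₂ := permCyc_swap_mul_le_permCyc_add_one (R * swap j b) j a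
  have h₃ := permCyc_le_permCyc_swap_mul_add_one R j b
  have h₄ := permCyc_le_permCyc_swap_mul_add_one (R * swap j b) j a
  rw [← hPR, permCyc_mul_swap] at h₂ h₄
  rw [permS2, permS2, ← hP, ← hQ]
  omega
end
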